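/- For every skew brace B, the subgroup of (G_B,·) generated by ι(0) is an ideal of G_B which is central in G_B (its elements commute with every element of G_B both additively and multiplicatively), on which the two operations + and · coincide, and which is an infinite cyclic group; that is, it is isomorphic as a skew brace to the trivial (abelian) skew brace on the integers. -/

import Mathlib

/-!
Common definitions: skew braces, set-theoretic solutions of the Yang–Baxter
equation, structure skew braces, ideals, i-homomorphisms, solubility.
-/

universe u v

/-- A skew (left) brace: two group structures `(B,+)` and `(B,·)` sharing the
same identity `0`, with `a·(b+c) = a·b − a + a·c`. -/
structure SkewBrace (B : Type u) where
  add : B → B → B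
  zero : B
  neg : B → B
  mul : B → B → B
  inv : B → B
  add_assoc : ∀ a b c, add (add a b) c = add a (add b c)
  zero_add : ∀ a, add zero a = a
  add_zero : ∀ a, add a zero = a
  neg_add : ∀ a, add (neg a) a = zero
  add_neg : ∀ a, add a (neg a) = zero
  mul_assoc : ∀ a b c, mul (mul a b) c = mul a (mul b c)
  zero_mul : ∀ a, mul zero a = a
  mul_zero : ∀ a, mul a zero = a
  inv_mul : ∀ a, mul (inv a) a = zero
  mul_inv : ∀ a, mul a (inv a) = zero
  compat : ∀ a b c, mul a (add b c) = add (add (mul a b) (neg a)) (mul a c)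

namespace SkewBrace

variable {B : Type u} (S : SkewBrace B)

/-- `λ_a(b) = −a + a·b`. -/
def lam (a b : B) : B := S.add (S.neg a) (S.mul a b)

/-- `ρ_b(a) = λ_a(b)⁻¹ · a · b`. -/
def rho (b a : B) : B := S.mul (S.mul (S.inv (S.lam a b)) a) b

/-- The solution of the YBE associated with a skew brace:
`r_B(a,b) = (λ_a(b), ρ_b(a))`. -/
def rB : B × B → B × B := fun p => (S.lam p.1 p.2, S.rho p.2 p.1)

end SkewBrace

/-- Homomorphism of skew braces: preserves both operations. -/
def IsHom {B : Type u} {C : Type v} (S : SkewBrace B) (T : SkewBrace C) (f : B → C) : Prop :=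
  (∀ a b, f (S.add a b) = T.add (f a) (f b)) ∧ (∀ a b, f (S.mul a b) = T.mul (f a) (f b))

/-- The kernel of a skew brace homomorphism: preimage of `0`. -/
def brKer {B : Type u} {C : Type v} (T : SkewBrace C) (f : B → C) : Set B :=
  {a | f a = T.zero}

/-- An ideal of a skew brace: a sub-skew brace, normal in both `(B,+)` and `(B,·)`,
and `λ_b`-invariant for all `b`. -/
def IsIdeal {B : Type u} (S : SkewBrace B) (I : Set B) : Prop :=
  S.zero ∈ I ∧
  (∀ a ∈ I, ∀ b ∈ I, S.add a b ∈ I) ∧ (∀ a ∈ I, S.neg a ∈ I) ∧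
  (∀ a ∈ I, ∀ b ∈ I, S.mul a b ∈ I) ∧ (∀ a ∈ I, S.inv a ∈ I) ∧
  (∀ b : B, ∀ a ∈ I, S.add (S.add b a) (S.neg b) ∈ I) ∧
  (∀ b : B, ∀ a ∈ I, S.mul (S.mul b a) (S.inv b) ∈ I) ∧
  (∀ b : B, S.lam b '' I = I)

/-- A skew brace is simple if it is non-trivial and its only ideals are `{0}` and `B`. -/
def IsSimpleBrace {B : Type u} (S : SkewBrace B) : Prop :=
  (∃ a : B, a ≠ S.zero) ∧
  ∀ I : Set B, IsIdeal S I → I = {S.zero} ∨ I = Set.univ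

/-- The socle of a skew brace: elements `a` with `λ_a = id` commuting additively
with everything. -/
def Soc {B : Type u} (S : SkewBrace B) : Set B :=
  {a | (∀ b, S.lam a b = b) ∧ (∀ b, S.add a b = S.add b a)}

/-- `r × id` on triples. -/
def rOne {X : Type u} (r : X × X → X × X) : X × X × X → X × X × X :=
  fun p => ((r (p.1, p.2.1)).1, (r (p.1, p.2.1)).2, p.2.2)

/-- `id × r` on triples. -/
def rTwo {X : Type u} (r : X × X → X × X) : X × X × X → X × X × X :=
  fun p => (p.1, r p.2)

/-- `(X,r)` is a set-theoretic solution of the Yang–Baxter equation. -/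
def IsSolution {X : Type u} (r : X × X → X × X) : Prop :=
  Function.Bijective r ∧
  rOne r ∘ rTwo r ∘ rOne r = rTwo r ∘ rOne r ∘ rTwo r

/-- `λ_x(y)` for a solution, i.e. the first component of `r(x,y)`. -/
def lamMap {X : Type u} (r : X × X → X × X) (x : X) : X → X := fun y => (r (x, y)).1

/-- `ρ_y(x)` for a solution, i.e. the second component of `r(x,y)`. -/
def rhoMap {X : Type u} (r : X × X → X × X) (y : X) : X → X := fun x => (r (x, y)).2

/-- Non-degeneracy: all `λ_x` and `ρ_y` are bijective. -/
def Nondeg {X : Type u} (r : X × X → X × X) : Prop :=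
  (∀ x, Function.Bijective (lamMap r x)) ∧ (∀ y, Function.Bijective (rhoMap r y))

/-- Homomorphism of solutions: `(f×f)∘r = s∘(f×f)`. -/
def IsSolHom {X : Type u} {Y : Type v} (r : X × X → X × X) (s : Y × Y → Y × Y)
    (f : X → Y) : Prop :=
  Prod.map f f ∘ r = s ∘ Prod.map f f

/-- The structure skew brace `(G_X, ι)` of a solution `(X,r)`: the image of `ι`
generates `(G_X,·)`, `ι` intertwines `r` with `r_{G_X}`, and the pair has the
universal property for maps into skew braces. -/
structure StructureBrace {X : Type u} (r : X × X → X × X) where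
  G : Type u
  S : SkewBrace G
  ι : X → G
  gen : ∀ H : Set G, S.zero ∈ H → (∀ a ∈ H, ∀ b ∈ H, S.mul a b ∈ H) →
      (∀ a ∈ H, S.inv a ∈ H) → Set.range ι ⊆ H → H = Set.univ
  compat : Prod.map ι ι ∘ r = S.rB ∘ Prod.map ι ι
  univ : ∀ {C : Type u} (T : SkewBrace C) (g : X → C),
      Prod.map g g ∘ r = T.rB ∘ Prod.map g g →
      ∃! h : G → C, IsHom S T h ∧ h ∘ ι = g

/-- The multiplicative subgroup (as a set) generated by a subset. -/
def mulClosure {B : Type u} (S : SkewBrace B) (A : Set B) : Set B :=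
  ⋂₀ {H : Set B | S.zero ∈ H ∧ (∀ a ∈ H, ∀ b ∈ H, S.mul a b ∈ H) ∧
      (∀ a ∈ H, S.inv a ∈ H) ∧ A ⊆ H}

/-- The additive subgroup (as a set) generated by a subset. -/
def addClosure {B : Type u} (S : SkewBrace B) (A : Set B) : Set B :=
  ⋂₀ {H : Set B | S.zero ∈ H ∧ (∀ a ∈ H, ∀ b ∈ H, S.add a b ∈ H) ∧
      (∀ a ∈ H, S.neg a ∈ H) ∧ A ⊆ H}

/-- The ideal generated by a subset: intersection of all ideals containing it. -/
def idealClosure {B : Type u} (S : SkewBrace B) (A : Set B) : Set B :=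
  ⋂₀ {I : Set B | IsIdeal S I ∧ A ⊆ I}

/-- Product of two subsets in the multiplicative group. -/
def setMul {B : Type u} (S : SkewBrace B) (A₁ A₂ : Set B) : Set B :=
  {c | ∃ a ∈ A₁, ∃ b ∈ A₂, c = S.mul a b}

/-- Sum of two subsets in the additive group. -/
def setAdd {B : Type u} (S : SkewBrace B) (A₁ A₂ : Set B) : Set B :=
  {c | ∃ a ∈ A₁, ∃ b ∈ A₂, c = S.add a b}

/-- The multiplicative left coset `a·I`. -/
def lCoset {B : Type u} (S : SkewBrace B) (a : B) (I : Set B) : Set B :=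
  (fun w => S.mul a w) '' I

/-- Equivalence class of the kernel relation of a map. -/
def kerClass {X : Type u} {Y : Type v} (f : X → Y) (x : X) : Set X := {z | f z = f x}

/-- `X₀` is an i-kernel of the homomorphism of solutions `f : (X,r) → (Y,s)`:
`f` is a homomorphism of solutions, `X₀` is an equivalence class of `ker f`, and
for every class `Z` of `ker f`, `r(X₀ × Z) = Z × X₀` and `r(Z × X₀) = X₀ × Z`.
A homomorphism admitting such a class is an i-homomorphism. -/
def IsIKernel {X : Type u} {Y : Type v} (r : X × X → X × X) (s : Y × Y → Y × Y)
    (f : X → Y) (X₀ : Set X) : Prop :=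
  IsSolHom r s f ∧ (∃ x : X, X₀ = kerClass f x) ∧
  ∀ z : X, r '' (X₀ ×ˢ kerClass f z) = (kerClass f z) ×ˢ X₀ ∧
           r '' ((kerClass f z) ×ˢ X₀) = X₀ ×ˢ (kerClass f z)

/-- A strong left ideal: a `λ`-invariant subgroup of `(B,+)` which is normal
in `(B,+)`. -/
def IsStrongLeftIdeal {B : Type u} (S : SkewBrace B) (I : Set B) : Prop :=
  S.zero ∈ I ∧ (∀ a ∈ I, ∀ b ∈ I, S.add a b ∈ I) ∧ (∀ a ∈ I, S.neg a ∈ I) ∧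
  (∀ b : B, S.lam b '' I = I) ∧
  (∀ b : B, ∀ a ∈ I, S.add (S.add b a) (S.neg b) ∈ I)

/-- An abelian ideal: an ideal on which the two operations coincide and are
commutative (so it is an abelian/trivial skew brace). -/
def IsAbelianIdeal {C : Type u} (T : SkewBrace C) (J : Set C) : Prop :=
  IsIdeal T J ∧ ∀ a ∈ J, ∀ b ∈ J, T.mul a b = T.add a b ∧ T.add a b = T.add b a

/-- Solubility of a skew brace: epimorphisms `f_k : B → B_k`, `0 ≤ k ≤ t`, with
`Ker f_t = 0 ⊆ … ⊆ Ker f_0 = B` and `f_k(Ker f_{k−1})` an abelian ideal of `B_k`. -/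
def IsSoluble {B : Type u} (S : SkewBrace B) : Prop :=
  ∃ (t : ℕ) (C : Fin (t + 1) → Type u) (T : ∀ k, SkewBrace (C k)) (f : ∀ k, B → C k),
    (∀ k, IsHom S (T k) (f k) ∧ Function.Surjective (f k)) ∧
    brKer (T (Fin.last t)) (f (Fin.last t)) = {S.zero} ∧
    brKer (T 0) (f 0) = Set.univ ∧
    (∀ k : Fin t, brKer (T k.succ) (f k.succ) ⊆ brKer (T k.castSucc) (f k.castSucc)) ∧
    (∀ k : Fin t, IsAbelianIdeal (T k.succ) (f k.succ '' brKer (T k.castSucc) (f k.castSucc)))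

/-- Solubility of a solution `(X,r)` (with structure skew brace `(G_X, ι)`):
there are skew braces `B_0,…,B_t`, i-epimorphisms `f_k : (X,r) → (B_k, r_{B_k})`
with i-kernels `X_k` for `0 ≤ k ≤ t−1`, and an epimorphism `f_t`, such that
`ker f_k ⊆ ker f_{k−1}`, `ker f_0` is total, `ker f_t ⊆ ker ι`, and each
`f_k(X_{k−1})` lies in an abelian ideal `J` of `B_k` with `f_k(x)·J = f_k(y)·J`
whenever `x (ker f_{k−1}) y`. -/
def IsSolubleSolution {X : Type u} (r : X × X → X × X) (GX : StructureBrace r) : Prop :=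
  ∃ (t : ℕ) (C : Fin (t + 1) → Type u) (T : ∀ k, SkewBrace (C k))
    (f : ∀ k : Fin (t + 1), X → C k) (Xk : Fin t → Set X),
    (∀ k : Fin (t + 1), IsSolHom r (T k).rB (f k) ∧ Function.Surjective (f k)) ∧
    (∀ k : Fin t, IsIKernel r (T k.castSucc).rB (f k.castSucc) (Xk k)) ∧
    (∀ x y : X, f 0 x = f 0 y) ∧
    (∀ k : Fin t, ∀ x y : X, f k.succ x = f k.succ y → f k.castSucc x = f k.castSucc y) ∧
    (∀ x y : X, f (Fin.last t) x = f (Fin.last t) y → GX.ι x = GX.ι y) ∧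
    (∀ k : Fin t, ∃ J : Set (C k.succ), IsAbelianIdeal (T k.succ) J ∧
      f k.succ '' (Xk k) ⊆ J ∧
      ∀ x y : X, f k.castSucc x = f k.castSucc y →
        lCoset (T k.succ) (f k.succ x) J = lCoset (T k.succ) (f k.succ y) J)

/-- Decomposability of a solution: `X = Y ∪ Z` with `Y, Z` proper and
`r(Y×Y) = Y×Y`, `r(Z×Z) = Z×Z`. -/
def Decomposable {X : Type u} (r : X × X → X × X) : Prop :=
  ∃ Y Z : Set X, Y ≠ Set.univ ∧ Z ≠ Set.univ ∧ Y ∪ Z = Set.univ ∧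
    r '' (Y ×ˢ Y) = Y ×ˢ Y ∧ r '' (Z ×ˢ Z) = Z ×ˢ Z

namespace SkewBrace

variable {B : Type u} (S : SkewBrace B)

/-- The multiplicative group of a skew brace. -/
abbrev mulGroup : Group B :=
  { mul := S.mul
    mul_assoc := S.mul_assoc
    one := S.zero
    one_mul := S.zero_mul
    mul_one := S.mul_zero
    inv := S.inv
    inv_mul_cancel := S.inv_mul }

/-- The additive group of a skew brace. -/
abbrev addGroup : AddGroup B :=
  { add := S.add
    add_assoc := S.add_assoc
    zero := S.zero
    zero_add := S.zero_add
    add_zero := S.add_zero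
    neg := S.neg
    neg_add_cancel := S.neg_add
    nsmul := @nsmulRec B ⟨S.zero⟩ ⟨S.add⟩
    zsmul := @zsmulRec B ⟨S.zero⟩ ⟨S.add⟩ ⟨S.neg⟩ (@nsmulRec B ⟨S.zero⟩ ⟨S.add⟩) }

theorem add_lam (a b : B) : S.add a (S.lam a b) = S.mul a b := by
  rw [lam, ← S.add_assoc, S.add_neg, S.zero_add]

theorem add_left_cancel {a b c : B} (h : S.add a b = S.add a c) : b = c := by
  let := S.addGroup
  exact _root_.add_left_cancel (a := a) h

theorem lam_add (a b c : B) : S.lam a (S.add b c) = S.add (S.lam a b) (S.lam a c) := by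
  simp only [lam, S.compat, S.add_assoc]

theorem lam_mul (a b c : B) : S.lam (S.mul a b) c = S.lam a (S.lam b c) := by
  apply S.add_left_cancel (a := S.mul a b)
  rw [S.add_lam, ← S.add_lam a b, S.add_assoc, ← S.lam_add, S.add_lam b, S.add_lam, S.mul_assoc, S.add_lam]

theorem lam_zero_left (a : B) : S.lam S.zero a = a := by
  rw [← S.zero_add (S.lam _ _), S.add_lam, S.zero_mul]

theorem lam_zero_right (a : B) : S.lam a S.zero = S.zero := by
  rw [lam, S.mul_zero, S.neg_add]

theorem lam_neg (a b : B) : S.lam a (S.neg b) = S.neg (S.lam a b) := by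
  apply S.add_left_cancel (a := S.lam a b)
  rw [← S.lam_add, S.add_neg, S.add_neg, S.lam_zero_right]

theorem inv_eq_neg_lam (a : B) : S.inv a = S.neg (S.lam (S.inv a) a) := by
  let := S.addGroup
  have h : S.inv a + S.lam (S.inv a) a = 0 := by
    change S.add _ _ = S.zero
    rw [S.add_lam, S.inv_mul]
  exact eq_neg_of_add_eq_zero_left h

/-- `λ_a(b) · ρ_b(a) = a · b`. -/
theorem lam_mul_rho (a b : B) : S.mul (S.lam a b) (S.rho b a) = S.mul a b := by
  rw [rho, S.mul_assoc, ← S.mul_assoc _ (S.inv _), S.mul_inv, S.zero_mul]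

theorem rB_zero_left (b : B) : S.rB (S.zero, b) = (b, S.zero) := by
  simp only [rB, rho, S.lam_zero_left, S.mul_zero, S.inv_mul]

theorem rB_zero_right (a : B) : S.rB (a, S.zero) = (S.zero, a) := by
  let := S.mulGroup
  have h : S.inv S.zero = S.zero := inv_one (G := B)
  simp only [rB, rho, S.lam_zero_right, S.mul_zero, h, S.zero_mul]

/-- The multiplicative subgroup of the elements that act trivially through `λ`, are fixed by
every `λ_v`, and are central in the multiplicative group. -/
def trivCenter : @Subgroup B S.mulGroup :=
  letI := S.mulGroup
  { carrier := {w | ∀ v, S.lam w v = v ∧ S.lam v w = w ∧ S.mul w v = S.mul v w}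
    one_mem' := fun v =>
      ⟨S.lam_zero_left v, S.lam_zero_right v, (S.zero_mul v).trans (S.mul_zero v).symm⟩
    mul_mem' := by
      intro a b ha hb v
      have hab : a * b = S.add a b := by
        change S.mul a b = _
        rw [← S.add_lam, (ha b).1]
      refine ⟨?_, ?_, ?_⟩
      · change S.lam (S.mul a b) _ = _
        rw [S.lam_mul, (hb v).1, (ha v).1]
      · rw [hab, S.lam_add, (ha v).2.1, (hb v).2.1]
      · exact Commute.mul_left (show Commute a v from (ha v).2.2)
          (show Commute b v from (hb v).2.2)
    inv_mem' := by
      intro a ha v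
      have hinv : a⁻¹ = S.neg a := by
        change S.inv a = _
        rw [S.inv_eq_neg_lam, (ha _).2.1]
      refine ⟨?_, ?_, ?_⟩
      · change S.lam (S.inv a) v = v
        conv_lhs => rw [← (ha v).1, ← S.lam_mul, S.inv_mul, S.lam_zero_left]
      · rw [hinv, S.lam_neg, (ha v).2.1]
      · exact Commute.inv_left (show Commute a v from (ha v).2.2) }

variable {S}

theorem mul_eq_add_of_mem_trivCenter {w : B} (hw : w ∈ S.trivCenter) (v : B) :
    S.mul w v = S.add w v := by
  rw [← S.add_lam, (hw v).1]

theorem add_comm_of_mem_trivCenter {w : B} (hw : w ∈ S.trivCenter) (v : B) :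
    S.add w v = S.add v w := by
  rw [← mul_eq_add_of_mem_trivCenter hw, (hw v).2.2, ← S.add_lam, (hw v).2.1]

theorem neg_eq_inv_of_mem_trivCenter {w : B} (hw : w ∈ S.trivCenter) : S.neg w = S.inv w := by
  rw [S.inv_eq_neg_lam, (hw _).2.1]

variable (S)

theorem mulClosure_eq_closure (A : Set B) :
    mulClosure S A = (@Subgroup.closure B S.mulGroup A : Set B) := by
  let := S.mulGroup
  apply Set.Subset.antisymm
  · exact Set.sInter_subset_of_mem ⟨one_mem (Subgroup.closure A), fun _ ha _ hb => mul_mem ha hb,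
      fun _ ha => inv_mem ha, Subgroup.subset_closure⟩
  · rintro x hx H ⟨h1, hmul, hinv, hA⟩
    let K : Subgroup B :=
      { carrier := H
        one_mem' := h1
        mul_mem' := fun ha hb => hmul _ ha _ hb
        inv_mem' := fun ha => hinv _ ha }
    exact (Subgroup.closure_le K).2 hA hx

/-- Every multiplicative subgroup of `trivCenter` is an ideal. -/
theorem isIdeal_of_le_trivCenter (H : @Subgroup B S.mulGroup)
    (hH : (H : Set B) ⊆ S.trivCenter) : IsIdeal S H := by
  let := S.mulGroup
  let := S.addGroup
  refine ⟨one_mem H, fun a ha b hb => ?_, fun a ha => ?_, fun a ha b hb => mul_mem ha hb,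
    fun a ha => inv_mem ha, fun b a ha => ?_, fun b a ha => ?_, fun b => ?_⟩
  · rw [← mul_eq_add_of_mem_trivCenter (hH ha)]
    exact mul_mem ha hb
  · rw [neg_eq_inv_of_mem_trivCenter (hH ha)]
    exact inv_mem ha
  · rw [← add_comm_of_mem_trivCenter (hH ha), S.add_assoc, S.add_neg, S.add_zero]
    exact ha
  · rw [← (hH ha b).2.2, S.mul_assoc, S.mul_inv, S.mul_zero]
    exact ha
  · calc S.lam b '' H = id '' (H : Set B) := Set.image_congr fun a ha => (hH ha b).2.1
      _ = H := Set.image_id _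

/-- The trivial skew brace on an additive commutative group. -/
def trivial (A : Type u) [AddCommGroup A] : SkewBrace A where
  add := (· + ·)
  zero := 0
  neg := Neg.neg
  mul := (· + ·)
  inv := Neg.neg
  add_assoc := _root_.add_assoc
  zero_add := _root_.zero_add
  add_zero := _root_.add_zero
  neg_add := neg_add_cancel
  add_neg := add_neg_cancel
  mul_assoc := _root_.add_assoc
  zero_mul := _root_.zero_add
  mul_zero := _root_.add_zero
  inv_mul := neg_add_cancel
  mul_inv := add_neg_cancel
  compat a b c := by abel

theorem trivial_rB (A : Type u) [AddCommGroup A] (a b : A) :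
    (trivial A).rB (a, b) = (b, a) := by
  simp [rB, rho, lam, trivial]

end SkewBrace

namespace StructureBrace

theorem ι_rB {X : Type u} {r : X × X → X × X} (GX : StructureBrace r) (x y : X) :
    GX.S.rB (GX.ι x, GX.ι y) = (GX.ι (r (x, y)).1, GX.ι (r (x, y)).2) :=
  (congrFun GX.compat (x, y)).symm

/-- An induction principle: a multiplicative subgroup containing `ι(X)` is everything. -/
theorem eq_top_of_range_subset {X : Type u} {r : X × X → X × X} (GX : StructureBrace r)
    (H : @Subgroup GX.G GX.S.mulGroup) (hH : ∀ x, GX.ι x ∈ H) (g : GX.G) : g ∈ H := by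
  let := GX.S.mulGroup
  have h := GX.gen H (one_mem H) (fun a ha b hb => mul_mem ha hb) (fun a ha => inv_mem ha)
    (Set.range_subset_iff.2 hH)
  exact (Set.ext_iff.1 h g).2 (Set.mem_univ g)

variable {B : Type u} {S : SkewBrace B} (GB : StructureBrace S.rB)

theorem lam_ι_zero_ι (b : B) : GB.S.lam (GB.ι S.zero) (GB.ι b) = GB.ι b := by
  have h := GB.ι_rB S.zero b
  rw [S.rB_zero_left] at h
  exact congrArg Prod.fst h

theorem lam_ι_ι_zero (a : B) : GB.S.lam (GB.ι a) (GB.ι S.zero) = GB.ι S.zero := by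
  have h := GB.ι_rB a S.zero
  rw [S.rB_zero_right] at h
  exact congrArg Prod.fst h

theorem mul_ι_ι_zero (a : B) :
    GB.S.mul (GB.ι a) (GB.ι S.zero) = GB.S.mul (GB.ι S.zero) (GB.ι a) := by
  have h := GB.ι_rB a S.zero
  rw [S.rB_zero_right] at h
  have hrho : GB.S.rho (GB.ι S.zero) (GB.ι a) = GB.ι a := congrArg Prod.snd h
  rw [← GB.S.lam_mul_rho, hrho, GB.lam_ι_ι_zero]

theorem mul_ι_zero_comm (g : GB.G) :
    GB.S.mul (GB.ι S.zero) g = GB.S.mul g (GB.ι S.zero) := by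
  let := GB.S.mulGroup
  have h := GB.eq_top_of_range_subset (Subgroup.centralizer {GB.ι S.zero})
    (fun a => Subgroup.mem_centralizer_singleton_iff.2 (GB.mul_ι_ι_zero a)) g
  exact (Subgroup.mem_centralizer_singleton_iff.1 h).symm

theorem lam_ι_zero_right (g : GB.G) : GB.S.lam g (GB.ι S.zero) = GB.ι S.zero := by
  let := GB.S.mulGroup
  refine GB.eq_top_of_range_subset
    { carrier := {g | GB.S.lam g (GB.ι S.zero) = GB.ι S.zero}
      one_mem' := GB.S.lam_zero_left _
      mul_mem' := ?_
      inv_mem' := ?_ } GB.lam_ι_ι_zero g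
  · intro a b ha hb
    change GB.S.lam (GB.S.mul a b) _ = _
    rw [GB.S.lam_mul, hb, ha]
  · intro a ha
    change GB.S.lam (GB.S.inv a) _ = _
    conv_lhs => rw [← ha, ← GB.S.lam_mul, GB.S.inv_mul, GB.S.lam_zero_left]

theorem lam_ι_zero_left (g : GB.G) : GB.S.lam (GB.ι S.zero) g = g := by
  let := GB.S.mulGroup
  have comm : ∀ a b : GB.G, GB.S.lam (GB.ι S.zero) (GB.S.lam a b) =
      GB.S.lam a (GB.S.lam (GB.ι S.zero) b) := fun a b => by
    rw [← GB.S.lam_mul, GB.mul_ι_zero_comm, GB.S.lam_mul]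
  refine GB.eq_top_of_range_subset
    { carrier := {g | GB.S.lam (GB.ι S.zero) g = g}
      one_mem' := GB.S.lam_zero_right _
      mul_mem' := ?_
      inv_mem' := ?_ } GB.lam_ι_zero_ι g
  · intro a b ha hb
    change GB.S.lam (GB.ι S.zero) (GB.S.mul a b) = GB.S.mul a b
    rw [← GB.S.add_lam, GB.S.lam_add, comm, ha, hb]
  · intro a ha
    change GB.S.lam (GB.ι S.zero) (GB.S.inv a) = GB.S.inv a
    rw [GB.S.inv_eq_neg_lam, GB.S.lam_neg, comm, ha]

theorem ι_zero_mem_trivCenter : GB.ι S.zero ∈ GB.S.trivCenter := fun v =>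
  ⟨GB.lam_ι_zero_left v, GB.lam_ι_zero_right v, GB.mul_ι_zero_comm v⟩

/-- The degree homomorphism from the multiplicative group, sending every `ι x` to `1`. -/
theorem exists_degree :
    letI := GB.S.mulGroup
    ∃ d : GB.G →* Multiplicative ℤ, ∀ x, d (GB.ι x) = Multiplicative.ofAdd 1 := by
  let := GB.S.mulGroup
  obtain ⟨h, ⟨⟨-, hmul⟩, hι⟩, -⟩ := GB.univ (SkewBrace.trivial (ULift.{u} ℤ)) (fun _ => ⟨1⟩) (by
    funext p
    exact (SkewBrace.trivial_rB (ULift.{u} ℤ) _ _).symm)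
  refine ⟨MonoidHom.mk' (fun g => Multiplicative.ofAdd (h g).down) fun a b => ?_, fun x => ?_⟩
  · exact congrArg (fun t : ULift.{u} ℤ => Multiplicative.ofAdd t.down) (hmul a b)
  · exact congrArg (fun t : ULift.{u} ℤ => Multiplicative.ofAdd t.down) (congrFun hι x)

end StructureBrace

/-- For every skew brace `B`, the subgroup of `(G_B,·)` generated by
`ι(0)` is an ideal of `G_B`, central (commutes with everything additively and
multiplicatively), the two operations coincide on it, and it is infinite cyclic:
isomorphic as a skew brace to the trivial abelian skew brace on `ℤ`. -/
theorem stmt_2 {B : Type u} (S : SkewBrace B) (GB : StructureBrace S.rB) :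
    IsIdeal GB.S (mulClosure GB.S {GB.ι S.zero}) ∧
    (∀ w ∈ mulClosure GB.S {GB.ι S.zero}, ∀ v : GB.G,
      GB.S.add w v = GB.S.add v w ∧ GB.S.mul w v = GB.S.mul v w) ∧
    (∀ w ∈ mulClosure GB.S {GB.ι S.zero}, ∀ v ∈ mulClosure GB.S {GB.ι S.zero},
      GB.S.mul w v = GB.S.add w v) ∧
    (∃ φ : ℤ → GB.G, Function.Injective φ ∧
      Set.range φ = mulClosure GB.S {GB.ι S.zero} ∧
      (∀ m n : ℤ, φ (m + n) = GB.S.mul (φ m) (φ n)) ∧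
      (∀ m n : ℤ, φ (m + n) = GB.S.add (φ m) (φ n))) := by
  let := GB.S.mulGroup
  have hcl : mulClosure GB.S {GB.ι S.zero} = (Subgroup.zpowers (GB.ι S.zero) : Set GB.G) := by
    rw [SkewBrace.mulClosure_eq_closure, Subgroup.zpowers_eq_closure]
  have hle : (Subgroup.zpowers (GB.ι S.zero) : Set GB.G) ⊆ GB.S.trivCenter :=
    Subgroup.zpowers_le.2 GB.ι_zero_mem_trivCenter
  obtain ⟨d, hd⟩ := GB.exists_degree
  rw [hcl]
  refine ⟨GB.S.isIdeal_of_le_trivCenter _ hle,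
    fun w hw v => ⟨SkewBrace.add_comm_of_mem_trivCenter (hle hw) v, (hle hw v).2.2⟩,
    fun w hw v _ => SkewBrace.mul_eq_add_of_mem_trivCenter (hle hw) v,
    fun n => GB.ι S.zero ^ n, fun m n hmn => ?_, rfl, fun m n => zpow_add _ m n, fun m n => ?_⟩
  · have h := congrArg (fun g => (d g).toAdd) hmn
    simpa [hd] using h
  · rw [← SkewBrace.mul_eq_add_of_mem_trivCenter (hle ⟨m, rfl⟩)]
    exact zpow_add _ m n
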